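/- Uniform convergence of the discrete smooth component: there exist constants C₀ > 0 and C, depending only on a, f, T and α but not on ε or N, such that for every ε ∈ (0,1], every N ≥ 1, and every mesh 0 = t_0 < ... < t_N = T with h_j ≤ C₀ N⁻¹ for all j, the mesh function V : {0,...,N} → ℝ defined by V_0 = v(0) and ε σ_j (V_j − V_{j−1})/h_j + a(t_j) V_j = f(t_j) for 1 ≤ j ≤ N satisfies max_{0 ≤ j ≤ N} |V_j − v(t_j)| ≤ C N⁻¹, where v is the smooth component. -/

import Mathlib

open Set

/-- Stability of the operator `ε y' + a y`: an upper barrier at a constant. -/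
lemma le_of_singular_ode {T α ε G K : ℝ} (hε : 0 < ε) (hG : 0 ≤ G) (hα : 0 < α)
    (hK : G < α * K) {a y y' g : ℝ → ℝ}
    (ha : ∀ t ∈ Icc (0:ℝ) T, α ≤ a t)
    (hy : ∀ t ∈ Icc (0:ℝ) T, HasDerivAt y (y' t) t)
    (hode : ∀ t ∈ Icc (0:ℝ) T, ε * y' t + a t * y t = g t)
    (hg : ∀ t ∈ Icc (0:ℝ) T, g t ≤ G) (h0 : y 0 ≤ K) :
    ∀ t ∈ Icc (0:ℝ) T, y t ≤ K := by
  have hK0 : 0 < K := pos_of_mul_pos_right (hG.trans_lt hK) hα.le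
  refine fun t ht => image_le_of_deriv_right_lt_deriv_boundary (B := fun _ => K) (B' := fun _ => 0)
    (fun s hs => (hy s hs).continuousAt.continuousWithinAt)
    (fun s hs => (hy s (Ico_subset_Icc_self hs)).hasDerivWithinAt) h0
    (fun s => hasDerivAt_const s K) (fun s hs hsK => ?_) ht
  have hs := Ico_subset_Icc_self hs
  have h1 := hode s hs
  have h2 := hg s hs
  have h3 := mul_le_mul_of_nonneg_right (ha s hs) hK0.le
  rw [hsK] at h1
  by_contra! hcon
  have h4 := mul_nonneg hε.le hcon
  linarith

lemma abs_le_of_singular_ode {T α ε G K : ℝ} (hε : 0 < ε) (hG : 0 ≤ G) (hα : 0 < α)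
    (hK : G < α * K) {a y y' g : ℝ → ℝ}
    (ha : ∀ t ∈ Icc (0:ℝ) T, α ≤ a t)
    (hy : ∀ t ∈ Icc (0:ℝ) T, HasDerivAt y (y' t) t)
    (hode : ∀ t ∈ Icc (0:ℝ) T, ε * y' t + a t * y t = g t)
    (hg : ∀ t ∈ Icc (0:ℝ) T, |g t| ≤ G) (h0 : |y 0| ≤ K) :
    ∀ t ∈ Icc (0:ℝ) T, |y t| ≤ K := by
  intro t ht
  refine abs_le'.2 ⟨le_of_singular_ode hε hG hα hK ha hy hode
    (fun s hs => (abs_le'.1 (hg s hs)).1) (abs_le'.1 h0).1 t ht, ?_⟩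
  refine le_of_singular_ode (y := fun s => -y s) (y' := fun s => -y' s) (g := fun s => -g s)
    hε hG hα hK ha (fun s hs => (hy s hs).neg) (fun s hs => ?_)
    (fun s hs => (abs_le'.1 (hg s hs)).2) (abs_le'.1 h0).2 t ht
  rw [← hode s hs]
  ring

/-- The fitting factor `x / (eˣ - 1)` lies in `[1 - x, 1]` and is positive. -/
lemma fittingFactor_bounds {x : ℝ} (hx : 0 < x) :
    0 < x / (Real.exp x - 1) ∧ x / (Real.exp x - 1) ≤ 1 ∧ 1 - x ≤ x / (Real.exp x - 1) := by
  have h1 := Real.add_one_le_exp x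
  have hd : 0 < Real.exp x - 1 := by linarith
  refine ⟨div_pos hx hd, (div_le_one hd).2 (by linarith), (le_div_iff₀ hd).2 ?_⟩
  have h2 := mul_le_mul_of_nonneg_right (Real.one_sub_le_exp_neg x) (Real.exp_pos x).le
  rw [← Real.exp_add, neg_add_cancel, Real.exp_zero] at h2
  linarith

/-- One step of the discrete stability estimate. -/
lemma abs_le_of_implicit_step {α b p x y τ D : ℝ} (hα : 0 < α) (hb : α ≤ b) (hp : 0 ≤ p)
    (hD : 0 ≤ D) (h : p * (x - y) + b * x = τ) (hτ : |τ| ≤ D) (hy : |y| ≤ D / α) :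
    |x| ≤ D / α := by
  have hpb : 0 < p + b := by linarith
  have h1 : (p + b) * |x| ≤ p * |y| + D := by
    calc (p + b) * |x| = |(p + b) * x| := by rw [abs_mul, abs_of_pos hpb]
      _ = |p * y + τ| := by congr 1; linarith
      _ ≤ |p * y| + |τ| := abs_add_le _ _
      _ ≤ p * |y| + D := by rw [abs_mul, abs_of_nonneg hp]; gcongr
  have h2 : D ≤ b * (D / α) := by
    calc D = α * (D / α) := by field_simp
      _ ≤ b * (D / α) := by gcongr
  have h3 := mul_le_mul_of_nonneg_left hy hp
  refine le_of_mul_le_mul_left ?_ hpb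
  linarith

/-- Truncation error of the fitted difference quotient for a function with `|v'| ≤ M` and
`ε |v''| ≤ S`. -/
lemma abs_truncation_le {ε s u M S A b : ℝ} (hε : 0 < ε) (hsu : s < u)
    (hb : 0 < b) (hbA : b ≤ A) {v v' v'' : ℝ → ℝ}
    (hv : ∀ t ∈ Icc s u, HasDerivAt v (v' t) t)
    (hv' : ∀ t ∈ Icc s u, HasDerivAt v' (v'' t) t)
    (hM : ∀ t ∈ Icc s u, |v' t| ≤ M) (hS : ∀ t ∈ Icc s u, |ε * v'' t| ≤ S) :
    |ε * v' u - ε * (b * ((u - s) / ε) / (Real.exp (b * ((u - s) / ε)) - 1)) *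
      (v u - v s) / (u - s)| ≤ (S + A * M) * (u - s) := by
  have hh : 0 < u - s := sub_pos.2 hsu
  obtain ⟨ξ, hξ, hξv⟩ := exists_hasDerivAt_eq_slope v v' hsu
    (fun t ht => (hv t ht).continuousAt.continuousWithinAt)
    (fun t ht => hv t (Ioo_subset_Icc_self ht))
  obtain ⟨η, hη, hηv⟩ := exists_hasDerivAt_eq_slope v' v'' hξ.2
    (fun t ht => (hv' t ⟨hξ.1.le.trans ht.1, ht.2⟩).continuousAt.continuousWithinAt)
    (fun t ht => hv' t ⟨hξ.1.le.trans ht.1.le, ht.2.le⟩)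
  have hx : 0 < b * ((u - s) / ε) := by positivity
  obtain ⟨-, hσ1, hσx⟩ := fittingFactor_bounds hx
  set σ := b * ((u - s) / ε) / (Real.exp (b * ((u - s) / ε)) - 1)
  have hξη : v' u - v' ξ = v'' η * (u - ξ) := by
    rw [hηv, div_mul_cancel₀ _ (sub_pos.2 hξ.2).ne']
  have hMξ := hM ξ (Ioo_subset_Icc_self hξ)
  have hSη := hS η ⟨hξ.1.le.trans hη.1.le, hη.2.le⟩
  have hM0 := (abs_nonneg _).trans hMξ
  have hS0 := (abs_nonneg _).trans hSη
  have hsplit : ε * v' u - ε * σ * (v u - v s) / (u - s)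
      = (ε * v'' η) * (u - ξ) + ε * (1 - σ) * v' ξ := by
    rw [mul_div_assoc, ← hξv]
    linear_combination ε * hξη
  have hεσ : ε * (1 - σ) ≤ A * (u - s) := by
    calc ε * (1 - σ) ≤ ε * (b * ((u - s) / ε)) := by gcongr; linarith
      _ = b * (u - s) := by field_simp
      _ ≤ A * (u - s) := by gcongr
  have hεσ0 : 0 ≤ ε * (1 - σ) := mul_nonneg hε.le (by linarith)
  calc |ε * v' u - ε * σ * (v u - v s) / (u - s)|
      ≤ |(ε * v'' η) * (u - ξ)| + |ε * (1 - σ) * v' ξ| := by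
        rw [hsplit]; exact abs_add_le _ _
    _ = |ε * v'' η| * (u - ξ) + ε * (1 - σ) * |v' ξ| := by
        rw [abs_mul, abs_mul (ε * (1 - σ)), abs_of_pos (sub_pos.2 hξ.2), abs_of_nonneg hεσ0]
    _ ≤ S * (u - s) + A * (u - s) * M := by
        have := hξ.1.le
        have := hεσ0.trans hεσ
        have := sub_pos.2 hξ.2
        gcongr
    _ = (S + A * M) * (u - s) := by ring

/-- Bounds, uniform in `ε`, for the smooth component and its derivatives. -/
lemma smooth_component_bounds {T α ε A A' F F' K M : ℝ} (hT : 0 < T) (hα : 0 < α) (hε : 0 < ε)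
    {a a' f f' v v' v'' : ℝ → ℝ}
    (ha_deriv : ∀ t ∈ Icc (0:ℝ) T, HasDerivAt a (a' t) t)
    (ha : ∀ t ∈ Icc (0:ℝ) T, α ≤ a t)
    (hf_deriv : ∀ t ∈ Icc (0:ℝ) T, HasDerivAt f (f' t) t)
    (hA : ∀ t ∈ Icc (0:ℝ) T, |a t| ≤ A) (hA' : ∀ t ∈ Icc (0:ℝ) T, |a' t| ≤ A')
    (hF : ∀ t ∈ Icc (0:ℝ) T, |f t| ≤ F) (hF' : ∀ t ∈ Icc (0:ℝ) T, |f' t| ≤ F')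
    (hK : F < α * K) (hM : F' + A' * K < α * M)
    (hv : ∀ t ∈ Icc (0:ℝ) T, HasDerivAt v (v' t) t)
    (hv' : ∀ t ∈ Icc (0:ℝ) T, HasDerivAt v' (v'' t) t)
    (hode : ∀ t ∈ Icc (0:ℝ) T, ε * v' t + a t * v t = f t)
    (hv0 : v 0 = f 0 / a 0) :
    (∀ t ∈ Icc (0:ℝ) T, |v' t| ≤ M) ∧
      ∀ t ∈ Icc (0:ℝ) T, |ε * v'' t| ≤ F' + A' * K + A * M := by
  have h0 : (0:ℝ) ∈ Icc 0 T := ⟨le_rfl, hT.le⟩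
  have ha0 : 0 < a 0 := hα.trans_le (ha 0 h0)
  have hF0 := (abs_nonneg _).trans (hF 0 h0)
  have hF'0 := (abs_nonneg _).trans (hF' 0 h0)
  have hA0 := (abs_nonneg _).trans (hA 0 h0)
  have hA'0 := (abs_nonneg _).trans (hA' 0 h0)
  have hK0 : 0 < K := pos_of_mul_pos_right (hF0.trans_lt hK) hα.le
  have hG0 : 0 ≤ F' + A' * K := by positivity
  have hM0 : 0 < M := pos_of_mul_pos_right (hG0.trans_lt hM) hα.le
  have hvK : ∀ t ∈ Icc (0:ℝ) T, |v t| ≤ K := by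
    refine abs_le_of_singular_ode hε hF0 hα hK ha hv hode hF ?_
    rw [hv0, abs_div, abs_of_pos ha0, div_le_iff₀ ha0]
    have := mul_le_mul_of_nonneg_right (ha 0 h0) hK0.le
    linarith [hF 0 h0]
  have hode' : ∀ t ∈ Icc (0:ℝ) T, ε * v'' t + a t * v' t = f' t - a' t * v t := by
    intro t ht
    have h1 : HasDerivWithinAt f (ε * v'' t + (a' t * v t + a t * v' t)) (Icc 0 T) t :=
      (((hv' t ht).const_mul ε).add ((ha_deriv t ht).mul (hv t ht))).hasDerivWithinAt.congr
        (fun s hs => (hode s hs).symm) (hode t ht).symm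
    have h2 := (uniqueDiffOn_Icc hT t ht).eq_deriv _ h1 (hf_deriv t ht).hasDerivWithinAt
    linarith
  have hg : ∀ t ∈ Icc (0:ℝ) T, |f' t - a' t * v t| ≤ F' + A' * K := by
    intro t ht
    calc |f' t - a' t * v t| ≤ |f' t| + |a' t| * |v t| := by
          rw [← abs_mul]; exact abs_sub _ _
      _ ≤ F' + A' * K := by gcongr; exacts [hF' t ht, hA' t ht, hvK t ht]
  have hv'0 : v' 0 = 0 := by
    have h1 := hode 0 h0
    rw [hv0, mul_div_cancel₀ _ ha0.ne', add_eq_right] at h1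
    exact (mul_eq_zero.1 h1).resolve_left hε.ne'
  have hv'M : ∀ t ∈ Icc (0:ℝ) T, |v' t| ≤ M :=
    abs_le_of_singular_ode hε hG0 hα hM ha hv' hode' hg (by rw [hv'0, abs_zero]; exact hM0.le)
  refine ⟨hv'M, fun t ht => ?_⟩
  calc |ε * v'' t| = |(f' t - a' t * v t) - a t * v' t| := by
        rw [← hode' t ht, add_sub_cancel_right]
    _ ≤ |f' t - a' t * v t| + |a t| * |v' t| := by
        rw [← abs_mul]; exact abs_sub _ _
    _ ≤ F' + A' * K + A * M := by gcongr; exacts [hg t ht, hA t ht, hv'M t ht]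

/-- Parameter-uniform first-order convergence of the discrete smooth component. -/
theorem uniform_convergence_smooth_component
    (T α : ℝ) (hT : 0 < T) (hα : 0 < α)
    (a a' f f' : ℝ → ℝ)
    (ha_deriv : ∀ t ∈ Set.Icc (0:ℝ) T, HasDerivAt a (a' t) t)
    (ha'_cont : ContinuousOn a' (Set.Icc 0 T))
    (ha : ∀ t ∈ Set.Icc (0:ℝ) T, α ≤ a t)
    (hf_deriv : ∀ t ∈ Set.Icc (0:ℝ) T, HasDerivAt f (f' t) t)
    (hf'_cont : ContinuousOn f' (Set.Icc 0 T)) :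
    ∃ C₀ : ℝ, 0 < C₀ ∧ ∃ C : ℝ, ∀ ε ∈ Set.Ioc (0:ℝ) 1, ∀ v v' v'' : ℝ → ℝ,
      (∀ t ∈ Set.Icc (0:ℝ) T, HasDerivAt v (v' t) t) →
      (∀ t ∈ Set.Icc (0:ℝ) T, HasDerivAt v' (v'' t) t) →
      (∀ t ∈ Set.Icc (0:ℝ) T, ε * v' t + a t * v t = f t) →
      v 0 = f 0 / a 0 →
      ∀ (N : ℕ), 1 ≤ N → ∀ t : ℕ → ℝ,
        t 0 = 0 → t N = T → (∀ j : ℕ, 1 ≤ j → j ≤ N → t (j - 1) < t j) →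
        (∀ j : ℕ, 1 ≤ j → j ≤ N → t j - t (j - 1) ≤ C₀ * (N : ℝ)⁻¹) →
        ∀ V : ℕ → ℝ, V 0 = v 0 →
        (∀ j : ℕ, 1 ≤ j → j ≤ N →
          ε * (a (t j) * ((t j - t (j - 1)) / ε) /
                (Real.exp (a (t j) * ((t j - t (j - 1)) / ε)) - 1)) *
              (V j - V (j - 1)) / (t j - t (j - 1)) + a (t j) * V j = f (t j)) →
        ∀ j : ℕ, j ≤ N → |V j - v (t j)| ≤ C * (N : ℝ)⁻¹ := by
  have h0 : (0:ℝ) ∈ Icc 0 T := ⟨le_rfl, hT.le⟩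
  obtain ⟨A, hA⟩ := isCompact_Icc.exists_bound_of_continuousOn
    (fun t ht => (ha_deriv t ht).continuousAt.continuousWithinAt)
  obtain ⟨A', hA'⟩ := isCompact_Icc.exists_bound_of_continuousOn ha'_cont
  obtain ⟨F, hF⟩ := isCompact_Icc.exists_bound_of_continuousOn
    (fun t ht => (hf_deriv t ht).continuousAt.continuousWithinAt)
  obtain ⟨F', hF'⟩ := isCompact_Icc.exists_bound_of_continuousOn hf'_cont
  simp only [Real.norm_eq_abs] at hA hA' hF hF'
  have exists_barrier : ∀ G : ℝ, ∃ K, G < α * K := fun G =>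
    ⟨(G + 1) / α, by rw [mul_div_cancel₀ _ hα.ne']; linarith⟩
  obtain ⟨K, hK⟩ := exists_barrier F
  obtain ⟨M, hM⟩ := exists_barrier (F' + A' * K)
  refine ⟨2 * T, by positivity, (F' + A' * K + A * M + A * M) * (2 * T) / α, ?_⟩
  -- Any positive `C₀` would do; for `C₀ < T` no mesh qualifies,
  -- and for `C₀ = T` only the uniform one.
  intro ε hε v v' v'' hv hv' hode hv0 N hN t ht0 htN hmono hstep V hV0 hV
  obtain ⟨hM', hS'⟩ := smooth_component_bounds hT hα hε.1 ha_deriv ha hf_deriv hA hA' hF hF' hK hM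
    hv hv' hode hv0
  have hL : 0 ≤ F' + A' * K + A * M + A * M :=
    add_nonneg ((abs_nonneg _).trans (hS' 0 h0))
      (mul_nonneg ((abs_nonneg _).trans (hA 0 h0)) ((abs_nonneg _).trans (hM' 0 h0)))
  set L := F' + A' * K + A * M + A * M
  have hlt : StrictMonoOn t (Icc 0 N) := strictMonoOn_of_lt_add_one ordConnected_Icc
    fun j _ _ hj => hmono (j + 1) (Nat.le_add_left 1 j) hj.2
  have hmem : ∀ j ≤ N, t j ∈ Icc (0:ℝ) T := fun j hj =>
    ⟨ht0 ▸ hlt.monotoneOn ⟨le_rfl, N.zero_le⟩ ⟨j.zero_le, hj⟩ j.zero_le,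
      htN ▸ hlt.monotoneOn ⟨j.zero_le, hj⟩ ⟨N.zero_le, le_rfl⟩ hj⟩
  have hD : 0 ≤ L * (2 * T * (N : ℝ)⁻¹) := by positivity
  have hmain : ∀ j ≤ N, |V j - v (t j)| ≤ L * (2 * T * (N : ℝ)⁻¹) / α := by
    intro j
    induction j with
    | zero =>
      intro _
      rw [hV0, ht0, sub_self, abs_zero]
      positivity
    | succ j ih =>
      intro hj
      have hs := hmem j (Nat.le_of_succ_le hj)
      have hu := hmem (j + 1) hj
      have hsu := hmono (j + 1) (Nat.le_add_left 1 j) hj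
      have hh := hstep (j + 1) (Nat.le_add_left 1 j) hj
      have hVj := hV (j + 1) (Nat.le_add_left 1 j) hj
      rw [Nat.add_sub_cancel] at hsu hh hVj
      have hsub : Icc (t j) (t (j + 1)) ⊆ Icc 0 T := Icc_subset_Icc hs.1 hu.2
      have hb : 0 < a (t (j + 1)) := hα.trans_le (ha _ hu)
      have hτ := abs_truncation_le hε.1 hsu hb ((le_abs_self _).trans (hA _ hu))
        (fun r hr => hv r (hsub hr)) (fun r hr => hv' r (hsub hr))
        (fun r hr => hM' r (hsub hr)) (fun r hr => hS' r (hsub hr))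
      have hpos : 0 < t (j + 1) - t j := sub_pos.2 hsu
      have hσ := (fittingFactor_bounds (mul_pos hb (div_pos hpos hε.1))).1
      set σ := a (t (j + 1)) * ((t (j + 1) - t j) / ε) /
        (Real.exp (a (t (j + 1)) * ((t (j + 1) - t j) / ε)) - 1)
      refine abs_le_of_implicit_step (p := ε * σ / (t (j + 1) - t j)) hα (ha _ hu)
        (div_nonneg (mul_nonneg hε.1.le hσ.le) hpos.le) hD ?_
        (hτ.trans (mul_le_mul_of_nonneg_left hh hL)) (ih (Nat.le_of_succ_le hj))
      linear_combination hVj - hode _ hu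
  intro j hj
  calc |V j - v (t j)| ≤ L * (2 * T * (N : ℝ)⁻¹) / α := hmain j hj
    _ = L * (2 * T) / α * (N : ℝ)⁻¹ := by ring
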